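/- Let n ≥ 1, let Q be a symmetric positive definite n × n real matrix, let q ∈ ℝⁿ, let C > 0, let y ∈ {−1, +1}ⁿ, and let z ∈ {0, 1}ⁿ with n_z = |{i : z_i = z}| > 0 for z = 0, 1. Let K = {μ ∈ ℝⁿ : 0 ≤ μ_i ≤ C for all i, and Σ_{i=1}^n y_i μ_i = 0}, and for each ε ∈ ℝ let μ(ε) be the unique minimizer over K of f_ε(μ) = ½ μᵀQμ − Σ_{i=1}^n μ_i + ε qᵀμ. Define the predicted-positive set P(ε) = {i : (μ_i(ε) < C and y_i = +1) or (μ_i(ε) = C and y_i = −1)} and the group welfares W_z(ε) = |{i ∈ P(ε) : z_i = z}| / n_z for z = 0, 1. Then there exists a finite set T ⊂ ℝ such that W_0 and W_1 are constant on every connected component of ℝ ∖ T; in particular, for any ε'' < ε' lying in the same component, the classification outcomes and both groups' welfares under the more fair tolerance ε'' are exactly those under the less fair tolerance ε'. -/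

import Mathlib

open Matrix
open scoped Classical

/-- The dual feasible set: box constraints `0 ≤ μ_i ≤ C` and the equality
constraint `∑ i, y_i μ_i = 0`. -/
def DualFeasible (n : ℕ) (y : Fin n → ℝ) (C : ℝ) (μ : Fin n → ℝ) : Prop :=
  (∀ i, 0 ≤ μ i ∧ μ i ≤ C) ∧ ∑ i, y i * μ i = 0

/-- The parametric dual objective `f_ε(μ) = ½ μᵀQμ − ∑ μ_i + ε qᵀμ`. -/
noncomputable def dualObj (n : ℕ) (Q : Matrix (Fin n) (Fin n) ℝ) (q : Fin n → ℝ)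
    (ε : ℝ) (μ : Fin n → ℝ) : ℝ :=
  (1 / 2) * (μ ⬝ᵥ Q.mulVec μ) - ∑ i, μ i + ε * (q ⬝ᵥ μ)

/-- A data point `i` is classified positively at dual solution `μ`: either it is
a non-error vector (`μ_i < C`) with true label `+1`, or an error vector (`μ_i = C`)
with true label `−1`. -/
def PosClassified (n : ℕ) (y : Fin n → ℝ) (C : ℝ) (μ : Fin n → ℝ) (i : Fin n) : Prop :=
  (μ i < C ∧ y i = 1) ∨ (μ i = C ∧ y i = -1)

/-- Group welfare: the fraction of group `g` classified positively at `μ`. -/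
noncomputable def groupWelfare (n : ℕ) (y : Fin n → ℝ) (z : Fin n → Fin 2)
    (C : ℝ) (μ : Fin n → ℝ) (g : Fin 2) : ℝ :=
  ((Finset.univ.filter fun i => PosClassified n y C μ i ∧ z i = g).card : ℝ) /
    ((Finset.univ.filter fun i => z i = g).card : ℝ)

open Filter Topology

/-- The gradient `Qμ - 1 + ε q` of the dual objective. -/
noncomputable def dualGrad (n : ℕ) (Q : Matrix (Fin n) (Fin n) ℝ) (q : Fin n → ℝ)
    (ε : ℝ) (μ : Fin n → ℝ) : Fin n → ℝ :=
  Q *ᵥ μ - 1 + ε • q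

/-- The sets of coordinates at which the lower and the upper box constraint are active. -/
def activeSets (n : ℕ) (C : ℝ) (μ : Fin n → ℝ) : Set (Fin n) × Set (Fin n) :=
  ({i | μ i = 0}, {i | μ i = C})

lemma dualObj_add_smul {n : ℕ} {Q : Matrix (Fin n) (Fin n) ℝ} (hQ : Q.IsSymm) (q : Fin n → ℝ)
    (ε s : ℝ) (μ d : Fin n → ℝ) :
    dualObj n Q q ε (μ + s • d) =
      dualObj n Q q ε μ + s * (dualGrad n Q q ε μ ⬝ᵥ d) + s ^ 2 / 2 * (d ⬝ᵥ Q *ᵥ d) := by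
  have hsymm : d ⬝ᵥ Q *ᵥ μ = μ ⬝ᵥ Q *ᵥ d := by
    rw [dotProduct_comm, ← vecMul_transpose, hQ.eq, ← dotProduct_mulVec]
  have hcomm : (Q *ᵥ μ) ⬝ᵥ d = μ ⬝ᵥ Q *ᵥ d := by rw [dotProduct_comm, hsymm]
  simp only [dualObj, dualGrad, mulVec_add, mulVec_smul, dotProduct_add, add_dotProduct,
    sub_dotProduct, smul_dotProduct, dotProduct_smul, smul_eq_mul, one_dotProduct, Pi.add_apply,
    Pi.smul_apply, Finset.sum_add_distrib, ← Finset.mul_sum, hsymm, hcomm]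
  ring

lemma dualFeasible_convex (n : ℕ) (y : Fin n → ℝ) (C : ℝ) :
    Convex ℝ {μ | DualFeasible n y C μ} := by
  rintro μ ⟨hμ, hμy⟩ ν ⟨hν, hνy⟩ a b ha hb hab
  refine ⟨fun i => convex_Icc 0 C (hμ i) (hν i) ha hb hab, ?_⟩
  have h : ∑ i, y i * (a • μ + b • ν) i = a * ∑ i, y i * μ i + b * ∑ i, y i * ν i := by
    simp only [Finset.mul_sum, ← Finset.sum_add_distrib, Pi.add_apply, Pi.smul_apply, smul_eq_mul]
    exact Finset.sum_congr rfl fun i _ => by ring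
  rw [h, hμy, hνy]
  simp

/-- First-order optimality along a direction in which one can move feasibly. -/
lemma dualGrad_dotProduct_nonneg {n : ℕ} {Q : Matrix (Fin n) (Fin n) ℝ} (hQ : Q.IsSymm)
    {q y : Fin n → ℝ} {C ε : ℝ} {μ d : Fin n → ℝ}
    (hopt : ∀ ν, DualFeasible n y C ν → dualObj n Q q ε μ ≤ dualObj n Q q ε ν)
    (hd : ∀ᶠ s : ℝ in 𝓝[>] 0, DualFeasible n y C (μ + s • d)) :
    0 ≤ dualGrad n Q q ε μ ⬝ᵥ d := by
  have hlim : Tendsto (fun s : ℝ => dualGrad n Q q ε μ ⬝ᵥ d + s / 2 * (d ⬝ᵥ Q *ᵥ d))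
      (𝓝[>] 0) (𝓝 (dualGrad n Q q ε μ ⬝ᵥ d)) := by
    have hc : Continuous fun s : ℝ => dualGrad n Q q ε μ ⬝ᵥ d + s / 2 * (d ⬝ᵥ Q *ᵥ d) := by
      fun_prop
    simpa using (hc.tendsto 0).mono_left nhdsWithin_le_nhds
  refine ge_of_tendsto hlim ?_
  filter_upwards [hd, self_mem_nhdsWithin] with s hs hs0
  have h := hopt _ hs
  rw [dualObj_add_smul hQ] at h
  refine (mul_nonneg_iff_of_pos_left (Set.mem_Ioi.1 hs0)).1 ?_
  linarith

lemma dualGrad_dotProduct_sub_nonneg {n : ℕ} {Q : Matrix (Fin n) (Fin n) ℝ} (hQ : Q.IsSymm)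
    {q y : Fin n → ℝ} {C ε : ℝ} {μ ν : Fin n → ℝ} (hμ : DualFeasible n y C μ)
    (hopt : ∀ ν, DualFeasible n y C ν → dualObj n Q q ε μ ≤ dualObj n Q q ε ν)
    (hν : DualFeasible n y C ν) :
    0 ≤ dualGrad n Q q ε μ ⬝ᵥ (ν - μ) := by
  refine dualGrad_dotProduct_nonneg hQ hopt ?_
  filter_upwards [Ioc_mem_nhdsGT (zero_lt_one' ℝ)] with s hs
  exact (dualFeasible_convex n y C).add_smul_sub_mem hμ hν ⟨hs.1.le, hs.2⟩

/-- If two feasible points have the same active box constraints, then the segment between them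
can be prolonged beyond its endpoints. -/
lemma eventually_dualFeasible_of_activeSets_eq {n : ℕ} {y : Fin n → ℝ} {C : ℝ}
    {μ ν : Fin n → ℝ} (hμ : DualFeasible n y C μ) (hν : DualFeasible n y C ν)
    (h : activeSets n C μ = activeSets n C ν) :
    ∀ᶠ s : ℝ in 𝓝[>] 0, DualFeasible n y C (μ + s • (μ - ν)) := by
  simp only [activeSets, Prod.mk.injEq, Set.ext_iff, Set.mem_ofPred_eq] at h
  have hbox : ∀ i, ∀ᶠ s : ℝ in 𝓝[>] 0, 0 ≤ μ i + s * (μ i - ν i) ∧ μ i + s * (μ i - ν i) ≤ C := by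
    intro i
    have hlim : Tendsto (fun s : ℝ => μ i + s * (μ i - ν i)) (𝓝[>] 0) (𝓝 (μ i)) := by
      have hc : Continuous fun s : ℝ => μ i + s * (μ i - ν i) := by fun_prop
      simpa using (hc.tendsto 0).mono_left nhdsWithin_le_nhds
    by_cases heq : μ i = ν i
    · simpa [heq] using hν.1 i
    · have h0 : μ i ≠ 0 := fun h0 => heq (by rw [h0, (h.1 i).1 h0])
      have hC : μ i ≠ C := fun hC => heq (by rw [hC, (h.2 i).1 hC])
      filter_upwards [hlim.eventually_const_lt ((hμ.1 i).1.lt_of_ne' h0),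
        hlim.eventually_lt_const ((hμ.1 i).2.lt_of_ne hC)] with s hs hs'
      exact ⟨hs.le, hs'.le⟩
  filter_upwards [eventually_all.2 hbox] with s hs
  refine ⟨hs, ?_⟩
  have hsum : ∑ i, y i * (μ + s • (μ - ν)) i =
      (1 + s) * ∑ i, y i * μ i - s * ∑ i, y i * ν i := by
    simp only [Finset.mul_sum, ← Finset.sum_sub_distrib, Pi.add_apply, Pi.sub_apply,
      Pi.smul_apply, smul_eq_mul]
    exact Finset.sum_congr rfl fun i _ => by ring
  rw [hsum, hμ.2, hν.2]
  simp

/-- A minimizer is equal to every feasible point satisfying the variational inequality. -/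
lemma eq_of_variational_inequality {n : ℕ} {Q : Matrix (Fin n) (Fin n) ℝ} (hQ : Q.IsSymm)
    (hQpd : Q.PosDef) {q : Fin n → ℝ} {ε : ℝ} {μ m : Fin n → ℝ}
    (hle : dualObj n Q q ε μ ≤ dualObj n Q q ε m)
    (hm : 0 ≤ dualGrad n Q q ε m ⬝ᵥ (μ - m)) : μ = m := by
  by_contra hne
  have hpos : 0 < (μ - m) ⬝ᵥ Q *ᵥ (μ - m) := by
    simpa using hQpd.dotProduct_mulVec_pos (sub_ne_zero.2 hne)
  have h := dualObj_add_smul hQ q ε 1 m (μ - m)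
  rw [one_smul, add_sub_cancel] at h
  linarith

/-- Convex combinations of two feasible points with the same active box constraints again have
these active box constraints. -/
lemma activeSets_convexComb {n : ℕ} {y : Fin n → ℝ} {C : ℝ} {μ ν : Fin n → ℝ}
    (hμ : DualFeasible n y C μ) (hν : DualFeasible n y C ν)
    (h : activeSets n C μ = activeSets n C ν) {a b : ℝ} (ha : 0 ≤ a) (hb : 0 ≤ b)
    (hab : a + b = 1) : activeSets n C (a • μ + b • ν) = activeSets n C μ := by
  simp only [activeSets, Prod.mk.injEq, Set.ext_iff, Set.mem_ofPred_eq] at h ⊢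
  refine ⟨fun i => ?_, fun i => ?_⟩
  · by_cases h0 : μ i = 0
    · simp [h0, (h.1 i).1 h0]
    · have h0' := mt (h.1 i).2 h0
      exact iff_of_false (convex_Ioi (0 : ℝ) ((hμ.1 i).1.lt_of_ne' h0)
        ((hν.1 i).1.lt_of_ne' h0') ha hb hab).ne' h0
  · by_cases hC : μ i = C
    · simp [hC, (h.2 i).1 hC, ← add_mul, hab]
    · have hC' := mt (h.2 i).2 hC
      exact iff_of_false (convex_Iio C ((hμ.1 i).2.lt_of_ne hC)
        ((hν.1 i).2.lt_of_ne hC') ha hb hab).ne hC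

/-- Along a path of minimizers, the parameters with prescribed active box constraints form a
convex set. -/
lemma convex_setOf_activeSets_eq {n : ℕ} {Q : Matrix (Fin n) (Fin n) ℝ} (hQ : Q.IsSymm)
    (hQpd : Q.PosDef) {q y : Fin n → ℝ} {C : ℝ} {μpath : ℝ → Fin n → ℝ}
    (hopt : ∀ ε : ℝ, DualFeasible n y C (μpath ε) ∧ ∀ ν : Fin n → ℝ, DualFeasible n y C ν →
      dualObj n Q q ε (μpath ε) ≤ dualObj n Q q ε ν)
    (p : Set (Fin n) × Set (Fin n)) :
    Convex ℝ {ε | activeSets n C (μpath ε) = p} := by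
  intro ε₁ h₁ ε₂ h₂ a b ha hb hab
  obtain ⟨f₁, o₁⟩ := hopt ε₁
  obtain ⟨f₂, o₂⟩ := hopt ε₂
  obtain ⟨f, o⟩ := hopt (a • ε₁ + b • ε₂)
  have h : activeSets n C (μpath ε₁) = activeSets n C (μpath ε₂) := h₁.trans h₂.symm
  set g₁ := dualGrad n Q q ε₁ (μpath ε₁)
  set g₂ := dualGrad n Q q ε₂ (μpath ε₂)
  have e₁ : 0 ≤ g₁ ⬝ᵥ (μpath ε₁ - μpath ε₂) :=
    dualGrad_dotProduct_nonneg hQ o₁ (eventually_dualFeasible_of_activeSets_eq f₁ f₂ h)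
  have e₂ : 0 ≤ g₂ ⬝ᵥ (μpath ε₂ - μpath ε₁) :=
    dualGrad_dotProduct_nonneg hQ o₂ (eventually_dualFeasible_of_activeSets_eq f₂ f₁ h.symm)
  have v₁ := dualGrad_dotProduct_sub_nonneg hQ f₁ o₁ f
  have v₂ := dualGrad_dotProduct_sub_nonneg hQ f₂ o₂ f
  have hgrad : dualGrad n Q q (a • ε₁ + b • ε₂) (a • μpath ε₁ + b • μpath ε₂) =
      a • g₁ + b • g₂ := by
    ext i
    simp only [g₁, g₂, dualGrad, mulVec_add, mulVec_smul, Pi.add_apply, Pi.sub_apply,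
      Pi.smul_apply, Pi.one_apply, smul_eq_mul]
    linear_combination hab
  have hpath : μpath (a • ε₁ + b • ε₂) = a • μpath ε₁ + b • μpath ε₂ := by
    refine eq_of_variational_inequality hQ hQpd
      (o _ (dualFeasible_convex n y C f₁ f₂ ha hb hab)) ?_
    rw [hgrad, add_dotProduct, smul_dotProduct, smul_dotProduct]
    have d₁ : μpath (a • ε₁ + b • ε₂) - (a • μpath ε₁ + b • μpath ε₂) =
        (μpath (a • ε₁ + b • ε₂) - μpath ε₁) + b • (μpath ε₁ - μpath ε₂) := by
      rw [eq_sub_of_add_eq hab]; module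
    have d₂ : μpath (a • ε₁ + b • ε₂) - (a • μpath ε₁ + b • μpath ε₂) =
        (μpath (a • ε₁ + b • ε₂) - μpath ε₂) + a • (μpath ε₂ - μpath ε₁) := by
      rw [eq_sub_of_add_eq' hab]; module
    refine add_nonneg (smul_nonneg ha ?_) (smul_nonneg hb ?_)
    · rw [d₁, dotProduct_add, dotProduct_smul]
      exact add_nonneg v₁ (smul_nonneg hb e₁)
    · rw [d₂, dotProduct_add, dotProduct_smul]
      exact add_nonneg v₂ (smul_nonneg ha e₂)
  rw [Set.mem_ofPred_eq, hpath, activeSets_convexComb f₁ f₂ h ha hb hab]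
  exact h₁

/-- A function to a finite type whose fibres are order-connected is constant on the intervals
that avoid a suitable finite set. -/
lemma exists_finset_forall_eq_of_ordConnected {α : Type*} [Finite α] (f : ℝ → α)
    (hf : ∀ p, (f ⁻¹' {p}).OrdConnected) :
    ∃ T : Finset ℝ, ∀ a b : ℝ, a ≤ b → (∀ t ∈ T, t ∉ Set.Icc a b) → f a = f b := by
  have := Fintype.ofFinite α
  refine ⟨Finset.univ.image fun p => sSup (f ⁻¹' {p}), fun a b hab hT => ?_⟩
  by_contra hne
  have hub : b ∈ upperBounds (f ⁻¹' {f a}) := by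
    intro x hx
    by_contra! hbx
    exact hne ((hf (f a)).out rfl hx ⟨hab, hbx.le⟩).symm
  exact hT _ (Finset.mem_image_of_mem _ (Finset.mem_univ (f a)))
    ⟨le_csSup ⟨b, hub⟩ rfl, csSup_le ⟨a, rfl⟩ hub⟩

lemma posClassified_congr {n : ℕ} {y : Fin n → ℝ} {C : ℝ} {μ ν : Fin n → ℝ}
    (hμ : DualFeasible n y C μ) (hν : DualFeasible n y C ν)
    (h : activeSets n C μ = activeSets n C ν) (i : Fin n) :
    PosClassified n y C μ i ↔ PosClassified n y C ν i := by
  have hi : μ i = C ↔ ν i = C := Set.ext_iff.1 (congrArg Prod.snd h) i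
  simp only [PosClassified, (hμ.1 i).2.lt_iff_ne, (hν.1 i).2.lt_iff_ne, ne_eq, hi]

/-- Along the minimizer path `ε ↦ μ(ε)` of the parametric quadratic
program, there is a finite set `T ⊂ ℝ` such that on every connected component of
`ℝ \ T` the classification outcomes and both groups' welfares `W_0, W_1` are constant:
for `ε'' ≤ ε'` in the same component, the outcomes under the more fair tolerance `ε''`
are exactly those under the less fair tolerance `ε'`. -/
theorem group_welfare_locally_constant
    (n : ℕ) (hn : 1 ≤ n)
    (Q : Matrix (Fin n) (Fin n) ℝ) (hQsymm : Q.IsSymm) (hQpd : Q.PosDef)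
    (q : Fin n → ℝ) (C : ℝ) (hC : 0 < C)
    (y : Fin n → ℝ) (hy : ∀ i, y i = 1 ∨ y i = -1)
    (z : Fin n → Fin 2)
    (hgroups : ∀ g : Fin 2, 0 < (Finset.univ.filter fun i => z i = g).card)
    (μpath : ℝ → (Fin n → ℝ))
    (hopt : ∀ ε : ℝ,
      DualFeasible n y C (μpath ε) ∧
      ∀ ν : Fin n → ℝ, DualFeasible n y C ν →
        dualObj n Q q ε (μpath ε) ≤ dualObj n Q q ε ν) :
    ∃ T : Finset ℝ, ∀ ε'' ε' : ℝ, ε'' ≤ ε' → (∀ t ∈ T, t ∉ Set.Icc ε'' ε') →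
      (∀ i : Fin n, PosClassified n y C (μpath ε'') i ↔ PosClassified n y C (μpath ε') i) ∧
      ∀ g : Fin 2, groupWelfare n y z C (μpath ε'') g = groupWelfare n y z C (μpath ε') g := by
  obtain ⟨T, hT⟩ := exists_finset_forall_eq_of_ordConnected
    (fun ε => activeSets n C (μpath ε))
    (fun p => (convex_setOf_activeSets_eq hQsymm hQpd hopt p).ordConnected)
  refine ⟨T, fun ε'' ε' hle hmem => ?_⟩
  have hpos : ∀ i, PosClassified n y C (μpath ε'') i ↔ PosClassified n y C (μpath ε') i :=
    posClassified_congr (hopt ε'').1 (hopt ε').1 (hT ε'' ε' hle hmem)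
  exact ⟨hpos, fun g => by simp only [groupWelfare, hpos]⟩
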